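/- In the exterior algebra Λ(ℝ⁷), let e₁,…,e₇ denote the images of the standard basis vectors, let Q = e₄∧e₅∧e₆∧e₇ + e₂∧e₃∧e₆∧e₇ − e₂∧e₃∧e₄∧e₅ + e₁∧e₃∧e₅∧e₇ + e₁∧e₃∧e₄∧e₆ + e₁∧e₂∧e₅∧e₆ − e₁∧e₂∧e₄∧e₇, and let P : Fin 7 → Fin 7 → Fin 7 → ℝ be the totally antisymmetric tensor determined by P(1,2,3) = P(1,4,5) = P(2,4,6) = P(2,5,7) = P(3,4,7) = 1 and P(1,6,7) = P(3,5,6) = −1 (all components not obtained from these by permutations being zero). Then Σ_{a,b,c,d,e} P(a,b,c)·P(a,d,e) • (e_b ∧ e_c ∧ e_d ∧ e_e) = −24 • Q, where the sum runs over all quintuples of indices. -/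

import Mathlib

/-- The image of the `i`-th standard basis vector of `ℝ⁷` in the exterior algebra
`Λ(ℝ⁷)` (indices shifted: `extE 0` is the vector `e₁`, …, `extE 6` is `e₇`). -/
noncomputable def extE (i : Fin 7) : ExteriorAlgebra ℝ (Fin 7 → ℝ) :=
  ExteriorAlgebra.ι ℝ (Pi.single i 1)

theorem extE_mul_self (i : Fin 7) : extE i * extE i = 0 :=
  ExteriorAlgebra.ι_sq_zero _

theorem extE_mul_swap (i j : Fin 7) : extE i * extE j = -(extE j * extE i) :=
  eq_neg_of_add_eq_zero_left (ExteriorAlgebra.ι_add_mul_swap _ _)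

theorem extE_mul_mul_swap (i j k : Fin 7) :
    extE i * extE j * extE k = -(extE i * extE k * extE j) := by
  rw [mul_assoc, extE_mul_swap j k, mul_neg, mul_assoc]

theorem extE_mul_mul_mul_swap (i j k l : Fin 7) :
    extE i * extE j * extE k * extE l = -(extE i * extE j * extE l * extE k) := by
  rw [mul_assoc, extE_mul_swap k l, mul_neg, mul_assoc _ (extE l)]

theorem commute_extE_mul_extE (i j k l : Fin 7) :
    Commute (extE i * extE j) (extE k * extE l) := by
  have h (m : Fin 7) : Commute (extE i * extE j) (extE m) := by
    rw [Commute, SemiconjBy, extE_mul_mul_swap, extE_mul_swap i m, neg_mul, neg_neg, mul_assoc]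
  exact (h k).mul_right (h l)

theorem extE_mul_extE_sq (i j : Fin 7) : (extE i * extE j) * (extE i * extE j) = 0 := by
  rw [← mul_assoc, extE_mul_mul_swap i j i, extE_mul_self, zero_mul, neg_zero, zero_mul]

/-- The square of a sum of three commuting elements of square zero. -/
theorem add_add_mul_self_of_commute {A : Type*} [Semiring A] {x y z : A}
    (hxy : Commute x y) (hxz : Commute x z) (hyz : Commute y z)
    (hx : x * x = 0) (hy : y * y = 0) (hz : z * z = 0) :
    (x + y + z) * (x + y + z) = 2 • (x * y + x * z + y * z) := by
  simp only [mul_add, add_mul, hx, hy, hz, hxy.eq, hxz.eq, hyz.eq]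
  abel

/-- The wedge square of a 2-form with three terms. -/
theorem smul_extE_mul_extE_sq (α β γ : ℝ) (i j k l m n : Fin 7) :
    (α • (extE i * extE j) + β • (extE k * extE l) + γ • (extE m * extE n))
        * (α • (extE i * extE j) + β • (extE k * extE l) + γ • (extE m * extE n))
      = (2 * α * β) • (extE i * extE j * extE k * extE l)
        + (2 * α * γ) • (extE i * extE j * extE m * extE n)
        + (2 * β * γ) • (extE k * extE l * extE m * extE n) := by
  rw [add_add_mul_self_of_commute
    (((commute_extE_mul_extE i j k l).smul_left α).smul_right β)
    (((commute_extE_mul_extE i j m n).smul_left α).smul_right γ)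
    (((commute_extE_mul_extE k l m n).smul_left β).smul_right γ)
    (by rw [smul_mul_smul_comm, extE_mul_extE_sq, smul_zero])
    (by rw [smul_mul_smul_comm, extE_mul_extE_sq, smul_zero])
    (by rw [smul_mul_smul_comm, extE_mul_extE_sq, smul_zero])]
  simp only [smul_mul_smul_comm, ← mul_assoc]
  module

/-- The third point on the line through two distinct points of the Fano plane whose lines are the
index triples of the 3-form: the nonzero vectors of `𝔽₂³` in binary, shifted down by one. -/
def fanoThird (a b : Fin 7) : Fin 7 :=
  Fin.ofNat 7 ((((a : ℕ) + 1) ^^^ ((b : ℕ) + 1)) - 1)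

/-- The components of a totally antisymmetric tensor at all permutations of its arguments. -/
theorem antisymm_components {α : Type*} {P : α → α → α → ℝ}
    (hP1 : ∀ x y z, P x y z = - P y x z) (hP2 : ∀ x y z, P x y z = - P x z y)
    {x y z : α} {v : ℝ} (h : P x y z = v) :
    P x y z = v ∧ P y z x = v ∧ P z x y = v ∧ P x z y = -v ∧ P y x z = -v ∧ P z y x = -v := by
  have h1 := hP2 x z y
  have h2 := hP1 y x z
  have h3 := hP2 y z x
  have h4 := hP1 z x y
  have h5 := hP2 z y x
  refine ⟨h, ?_, ?_, ?_, ?_, ?_⟩ <;> linarith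

/-- The double contraction of two bilinear tensors with a fourfold product is a product of
the associated quadratic elements. -/
theorem sum_smul_mul_eq_mul {ι R A : Type*} [Fintype ι] [CommSemiring R] [Semiring A]
    [Algebra R A] (B : ι → ι → R) (v : ι → A) :
    ∑ b, ∑ c, ∑ d, ∑ e, (B b c * B d e) • (v b * v c * v d * v e)
      = (∑ b, ∑ c, B b c • (v b * v c)) * ∑ b, ∑ c, B b c • (v b * v c) := by
  simp only [Finset.sum_mul]
  simp only [Finset.mul_sum, smul_mul_smul_comm, mul_assoc]

/-- The quadratic contraction identity `Σ P_{abc} P_{ade} e^b∧e^c∧e^d∧e^e = −24 Q` for the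
standard G₂ 3-form `P = e¹²³ + e¹⁴⁵ − e¹⁶⁷ + e²⁴⁶ + e²⁵⁷ + e³⁴⁷ − e³⁵⁶` on `ℝ⁷` and the
G₂ Casimir 4-form `Q = e⁴⁵⁶⁷ + e²³⁶⁷ − e²³⁴⁵ + e¹³⁵⁷ + e¹³⁴⁶ + e¹²⁵⁶ − e¹²⁴⁷`
(indices shifted down by one in `Fin 7`). -/
theorem nearly_parallel_g2_contraction
    (P : Fin 7 → Fin 7 → Fin 7 → ℝ)
    (hP1 : ∀ x y z, P x y z = - P y x z)
    (hP2 : ∀ x y z, P x y z = - P x z y)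
    (hv1 : P 0 1 2 = 1) (hv2 : P 0 3 4 = 1) (hv3 : P 0 5 6 = -1)
    (hv4 : P 1 3 5 = 1) (hv5 : P 1 4 6 = 1) (hv6 : P 2 3 6 = 1) (hv7 : P 2 4 5 = -1)
    (hzero : ∀ x y z : Fin 7,
      ({x, y, z} : Finset (Fin 7)) ≠ {0, 1, 2} →
      ({x, y, z} : Finset (Fin 7)) ≠ {0, 3, 4} →
      ({x, y, z} : Finset (Fin 7)) ≠ {0, 5, 6} →
      ({x, y, z} : Finset (Fin 7)) ≠ {1, 3, 5} →
      ({x, y, z} : Finset (Fin 7)) ≠ {1, 4, 6} →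
      ({x, y, z} : Finset (Fin 7)) ≠ {2, 3, 6} →
      ({x, y, z} : Finset (Fin 7)) ≠ {2, 4, 5} → P x y z = 0) :
    ∑ a : Fin 7, ∑ b : Fin 7, ∑ c : Fin 7, ∑ d : Fin 7, ∑ e : Fin 7,
        (P a b c * P a d e) • (extE b * extE c * extE d * extE e)
      = (-24 : ℝ) • (extE 3 * extE 4 * extE 5 * extE 6
          + extE 1 * extE 2 * extE 5 * extE 6
          - extE 1 * extE 2 * extE 3 * extE 4
          + extE 0 * extE 2 * extE 4 * extE 6
          + extE 0 * extE 2 * extE 3 * extE 5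
          + extE 0 * extE 1 * extE 4 * extE 5
          - extE 0 * extE 1 * extE 3 * extE 6) := by
  have hv1' := antisymm_components hP1 hP2 hv1
  have hv2' := antisymm_components hP1 hP2 hv2
  have hv3' := antisymm_components hP1 hP2 hv3
  have hv4' := antisymm_components hP1 hP2 hv4
  have hv5' := antisymm_components hP1 hP2 hv5
  have hv6' := antisymm_components hP1 hP2 hv6
  have hv7' := antisymm_components hP1 hP2 hv7
  have hdiag (a c : Fin 7) : P a a c = 0 := by linarith [hP1 a a c]
  have hsupp : ∀ a b c, c ≠ fanoThird a b → P a b c = 0 := by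
    intro a b c h
    apply hzero <;> (revert a b c; decide)
  have hrow (a b c : Fin 7) (h : c = fanoThird a b) :
      ∑ d, P a b d • (extE b * extE d) = P a b c • (extE b * extE c) :=
    Finset.sum_eq_single c (fun d _ hd => by rw [hsupp a b d (h ▸ hd), zero_smul]) (by simp)
  have hs0 : ∑ b, ∑ c, P 0 b c • (extE b * extE c)
      = (2 : ℝ) • (extE 1 * extE 2) + (2 : ℝ) • (extE 3 * extE 4)
        + (-2 : ℝ) • (extE 5 * extE 6) := by
    rw [Fin.sum_univ_seven, hrow 0 0 0 rfl, hrow 0 1 2 rfl, hrow 0 2 1 rfl,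
      hrow 0 3 4 rfl, hrow 0 4 3 rfl, hrow 0 5 6 rfl, hrow 0 6 5 rfl]
    simp only [hdiag, hv1', hv2', hv3', zero_smul,
      extE_mul_swap 2 1, extE_mul_swap 4 3, extE_mul_swap 6 5]
    module
  have hs1 : ∑ b, ∑ c, P 1 b c • (extE b * extE c)
      = (-2 : ℝ) • (extE 0 * extE 2) + (2 : ℝ) • (extE 3 * extE 5)
        + (2 : ℝ) • (extE 4 * extE 6) := by
    rw [Fin.sum_univ_seven, hrow 1 0 2 rfl, hrow 1 1 0 rfl, hrow 1 2 0 rfl,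
      hrow 1 3 5 rfl, hrow 1 4 6 rfl, hrow 1 5 3 rfl, hrow 1 6 4 rfl]
    simp only [hdiag, hv1', hv4', hv5', zero_smul,
      extE_mul_swap 2 0, extE_mul_swap 5 3, extE_mul_swap 6 4]
    module
  have hs2 : ∑ b, ∑ c, P 2 b c • (extE b * extE c)
      = (2 : ℝ) • (extE 0 * extE 1) + (2 : ℝ) • (extE 3 * extE 6)
        + (-2 : ℝ) • (extE 4 * extE 5) := by
    rw [Fin.sum_univ_seven, hrow 2 0 1 rfl, hrow 2 1 0 rfl, hrow 2 2 0 rfl,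
      hrow 2 3 6 rfl, hrow 2 4 5 rfl, hrow 2 5 4 rfl, hrow 2 6 3 rfl]
    simp only [hdiag, hv1', hv6', hv7', zero_smul,
      extE_mul_swap 1 0, extE_mul_swap 6 3, extE_mul_swap 5 4]
    module
  have hs3 : ∑ b, ∑ c, P 3 b c • (extE b * extE c)
      = (-2 : ℝ) • (extE 0 * extE 4) + (-2 : ℝ) • (extE 1 * extE 5)
        + (-2 : ℝ) • (extE 2 * extE 6) := by
    rw [Fin.sum_univ_seven, hrow 3 0 4 rfl, hrow 3 1 5 rfl, hrow 3 2 6 rfl,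
      hrow 3 3 0 rfl, hrow 3 4 0 rfl, hrow 3 5 1 rfl, hrow 3 6 2 rfl]
    simp only [hdiag, hv2', hv4', hv6', zero_smul,
      extE_mul_swap 4 0, extE_mul_swap 5 1, extE_mul_swap 6 2]
    module
  have hs4 : ∑ b, ∑ c, P 4 b c • (extE b * extE c)
      = (2 : ℝ) • (extE 0 * extE 3) + (-2 : ℝ) • (extE 1 * extE 6)
        + (2 : ℝ) • (extE 2 * extE 5) := by
    rw [Fin.sum_univ_seven, hrow 4 0 3 rfl, hrow 4 1 6 rfl, hrow 4 2 5 rfl,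
      hrow 4 3 0 rfl, hrow 4 4 0 rfl, hrow 4 5 2 rfl, hrow 4 6 1 rfl]
    simp only [hdiag, hv2', hv5', hv7', zero_smul,
      extE_mul_swap 3 0, extE_mul_swap 6 1, extE_mul_swap 5 2]
    module
  have hs5 : ∑ b, ∑ c, P 5 b c • (extE b * extE c)
      = (2 : ℝ) • (extE 0 * extE 6) + (2 : ℝ) • (extE 1 * extE 3)
        + (-2 : ℝ) • (extE 2 * extE 4) := by
    rw [Fin.sum_univ_seven, hrow 5 0 6 rfl, hrow 5 1 3 rfl, hrow 5 2 4 rfl,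
      hrow 5 3 1 rfl, hrow 5 4 2 rfl, hrow 5 5 0 rfl, hrow 5 6 0 rfl]
    simp only [hdiag, hv3', hv4', hv7', zero_smul,
      extE_mul_swap 6 0, extE_mul_swap 3 1, extE_mul_swap 4 2]
    module
  have hs6 : ∑ b, ∑ c, P 6 b c • (extE b * extE c)
      = (-2 : ℝ) • (extE 0 * extE 5) + (2 : ℝ) • (extE 1 * extE 4)
        + (2 : ℝ) • (extE 2 * extE 3) := by
    rw [Fin.sum_univ_seven, hrow 6 0 5 rfl, hrow 6 1 4 rfl, hrow 6 2 3 rfl,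
      hrow 6 3 2 rfl, hrow 6 4 1 rfl, hrow 6 5 0 rfl, hrow 6 6 0 rfl]
    simp only [hdiag, hv3', hv5', hv6', zero_smul,
      extE_mul_swap 5 0, extE_mul_swap 4 1, extE_mul_swap 3 2]
    module
  simp_rw [sum_smul_mul_eq_mul]
  rw [Fin.sum_univ_seven, hs0, hs1, hs2, hs3, hs4, hs5, hs6]
  simp only [smul_extE_mul_extE_sq, neg_mul, smul_neg, neg_neg, extE_mul_mul_swap 3 5 4,
    extE_mul_mul_swap 3 6 4, extE_mul_mul_mul_swap 3 4 6 5, extE_mul_mul_swap 0 4 1,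
    extE_mul_mul_swap 0 4 2, extE_mul_mul_swap 1 5 2, extE_mul_mul_swap 0 3 1,
    extE_mul_mul_swap 0 3 2, extE_mul_mul_swap 1 6 2, extE_mul_mul_mul_swap 1 2 6 5,
    extE_mul_mul_swap 0 6 1, extE_mul_mul_mul_swap 0 1 6 3, extE_mul_mul_swap 0 6 2,
    extE_mul_mul_mul_swap 0 2 6 4, extE_mul_mul_swap 1 3 2, extE_mul_mul_swap 0 5 1,
    extE_mul_mul_mul_swap 0 1 5 4, extE_mul_mul_swap 0 5 2, extE_mul_mul_mul_swap 0 2 5 3,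
    extE_mul_mul_swap 1 4 2, extE_mul_mul_mul_swap 1 2 4 3]
  module
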